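/- arXiv:2304.14384 — 4 statements merged into one kernel-verified Lean document; each statement's English description precedes it below -/
import Mathlib

section
/- (Corollary 2.14(3).) For every real number λ and every positive integer M with |w i| ≤ M for all i, one has μ_α − μ_λ = ∑_{k=1}^{M} (𝕎(λ·k) − 1)·(h_k − h_{−k}), where h_k := #{i | w i = k} for k ∈ ℤ. -/
open Classical in
/-- The function 𝕎 from Equation (32): `𝕎(x) = 2x` if `x ∈ ℤ`, and `𝕎(x) = 2⌊x⌋ + 1` otherwise. -/
noncomputable def W (x : ℝ) : ℤ :=
  if ∃ n : ℤ, (n : ℝ) = x then 2 * ⌊x⌋ else 2 * ⌊x⌋ + 1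

/-- The Floer-theoretic index `μ_λ = ∑_{i : w i ≠ 0} (1 − 𝕎(λ·w i))`. -/
noncomputable def muLambda {ι : Type*} [Fintype ι] (w : ι → ℤ) (lam : ℝ) : ℤ :=
  ∑ i ∈ Finset.univ.filter (fun i => w i ≠ 0), (1 - W (lam * (w i : ℝ)))

/-- The Morse–Bott index `μ_α = 2·#{i | w i < 0}`. -/
noncomputable def muAlpha {ι : Type*} [Fintype ι] (w : ι → ℤ) : ℤ :=
  2 * (Finset.univ.filter (fun i => w i < 0)).card

theorem W_neg (x : ℝ) : W (-x) = - W x := by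
  unfold W
  by_cases h : ∃ n : ℤ, (n : ℝ) = x
  · obtain ⟨n, rfl⟩ := h
    have h1 : ∃ m : ℤ, (m : ℝ) = -(n : ℝ) := ⟨-n, by push_cast; rfl⟩
    have h2 : ∃ m : ℤ, (m : ℝ) = (n : ℝ) := ⟨n, rfl⟩
    rw [if_pos h1, if_pos h2, ← Int.cast_neg, Int.floor_intCast, Int.floor_intCast]
    ring
  · have h1 : ¬ ∃ m : ℤ, (m : ℝ) = -x := by
      rintro ⟨m, hm⟩
      exact h ⟨-m, by push_cast; linarith⟩
    rw [if_neg h1, if_neg h]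
    have h3 : ⌊-x⌋ = -⌊x⌋ - 1 := by
      rw [Int.floor_eq_iff]
      have a := Int.floor_le x
      have b := Int.lt_floor_add_one x
      have c : (⌊x⌋ : ℝ) ≠ x := fun e => h ⟨_, e⟩
      have d := lt_of_le_of_ne a c
      push_cast
      constructor <;> linarith
    rw [h3]
    ring

theorem term_eq (lam : ℝ) (M : ℕ) (a : ℤ) (ha : |a| ≤ (M : ℤ)) :
    2 * (if a < 0 then (1 : ℤ) else 0) - (if a ≠ 0 then (1 - W (lam * (a : ℝ))) else 0) =
      ∑ k ∈ Finset.Icc 1 M, (W (lam * (k : ℝ)) - 1) *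
        ((if a = (k : ℤ) then (1 : ℤ) else 0) - (if a = -(k : ℤ) then (1 : ℤ) else 0)) := by
  by_cases h0 : a = 0
  · subst h0
    symm
    simp only [lt_irrefl, if_false, ne_eq, not_true_eq_false, mul_zero, sub_zero]
    apply Finset.sum_eq_zero
    intro k hk
    have := (Finset.mem_Icc.1 hk).1
    rw [if_neg (by omega), if_neg (by omega)]
    ring
  · rw [Finset.sum_eq_single a.natAbs]
    · rcases lt_or_gt_of_ne h0 with h | h
      · obtain ⟨n, rfl⟩ : ∃ n : ℕ, a = -(n : ℤ) := ⟨a.natAbs, by omega⟩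
        rw [if_pos h, if_pos h0, Int.natAbs_neg, Int.natAbs_natCast, if_neg (by omega),
          if_pos rfl]
        push_cast
        rw [mul_neg, W_neg]
        ring
      · obtain ⟨n, rfl⟩ : ∃ n : ℕ, a = (n : ℤ) := ⟨a.natAbs, by omega⟩
        rw [if_neg (by omega), if_pos h0, Int.natAbs_natCast, if_pos rfl, if_neg (by omega)]
        push_cast
        ring
    · intro k _ hk
      rw [if_neg (by omega), if_neg (by omega)]
      ring
    · intro hk
      rw [Int.abs_eq_natAbs] at ha
      exact absurd (Finset.mem_Icc.2 ⟨by omega, by omega⟩) hk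

/-- Corollary 2.14(3): `μ_α − μ_λ = ∑_{k=1}^{M} (𝕎(λk) − 1)(h_k − h_{−k})`, where
`h_k = #{i | w i = k}` and `M` bounds all the weights. -/
theorem muAlpha_sub_muLambda {ι : Type*} [Fintype ι] (w : ι → ℤ) (lam : ℝ)
    (M : ℕ) (hM : 0 < M) (hbd : ∀ i, |w i| ≤ (M : ℤ)) :
    muAlpha w - muLambda w lam =
      ∑ k ∈ Finset.Icc 1 M,
        (W (lam * (k : ℝ)) - 1) *
          (((Finset.univ.filter (fun i => w i = (k : ℤ))).card : ℤ)
            - ((Finset.univ.filter (fun i => w i = -(k : ℤ))).card : ℤ)) := by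
  unfold muAlpha muLambda
  simp only [Finset.card_filter, Finset.sum_filter]
  push_cast
  simp only [← Finset.sum_sub_distrib, Finset.mul_sum]
  rw [Finset.sum_comm]
  exact Finset.sum_congr rfl fun i _ => by
    simpa using term_eq lam M (w i) (hbd i)
end

section
/- (Corollary 2.14(5).) Let N be a natural number and λ a real number with N < λ and (λ − N)·|w i| < 1 for every index i with w i ≠ 0. Then μ_λ = μ_α − 2N·(∑ i, w i). -/
theorem W_of_between (x : ℝ) (k : ℤ) (h1 : (k : ℝ) < x) (h2 : x < k + 1) :
    W x = 2 * k + 1 := by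
  have hf : ⌊x⌋ = k := Int.floor_eq_iff.mpr ⟨h1.le, h2⟩
  have hn : ¬ ∃ n : ℤ, (n : ℝ) = x := by
    rintro ⟨n, rfl⟩
    have a : k < n := by exact_mod_cast h1
    have b : n < k + 1 := by exact_mod_cast h2
    omega
  rw [W, if_neg hn, hf]

/-- Corollary 2.14(5): for `N < λ < N + λ_α` (so `(λ − N)·|w i| < 1` for nonzero weights),
`μ_λ = μ_α − 2N·μ` where `μ = ∑ i, w i`. -/
theorem muLambda_eq_muAlpha_sub {ι : Type*} [Fintype ι] (w : ι → ℤ) (N : ℕ) (lam : ℝ)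
    (hN : (N : ℝ) < lam) (hsmall : ∀ i, w i ≠ 0 → (lam - (N : ℝ)) * |(w i : ℝ)| < 1) :
    muLambda w lam = muAlpha w - 2 * (N : ℤ) * (∑ i, w i) := by
  unfold muLambda muAlpha
  rw [Finset.card_filter, Finset.sum_filter, Finset.mul_sum]
  push_cast
  rw [Finset.mul_sum, ← Finset.sum_sub_distrib]
  refine Finset.sum_congr rfl fun i _ => ?_
  have hpos : 0 < lam - (N : ℝ) := sub_pos.mpr hN
  rcases lt_trichotomy (w i) 0 with h | h | h
  · have hs := hsmall i h.ne
    have hr : (w i : ℝ) < 0 := by exact_mod_cast h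
    rw [abs_of_neg hr] at hs
    have hm := mul_neg_of_pos_of_neg hpos hr
    rw [if_pos h.ne, if_pos h, W_of_between _ (N * w i - 1) (by push_cast; linarith)
      (by push_cast; linarith)]
    ring
  · simp [h]
  · have hs := hsmall i h.ne'
    have hr : (0 : ℝ) < w i := by exact_mod_cast h
    rw [abs_of_pos hr] at hs
    have hm := mul_pos hpos hr
    rw [if_pos h.ne', if_neg h.not_gt, W_of_between _ (N * w i) (by push_cast; linarith)
      (by push_cast; linarith)]
    ring
end

section
/- (Proposition 2.16, combinatorial form.) Suppose the weights are compatibly weighted, i.e. for every positive integer K one has #{i | K ≤ w i} ≥ #{i | w i ≤ −K}. Then for every real λ > 0 one has μ_λ ≤ μ_α. -/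
theorem W_eq (x : ℝ) : W x = ⌊x⌋ + ⌈x⌉ := by
  unfold W
  split_ifs with h
  · obtain ⟨n, rfl⟩ := h
    simp; ring
  · have h1 : ⌈x⌉ = ⌊x⌋ + 1 := by
      rw [Int.ceil_eq_iff]
      have hl := Int.floor_le x
      have hu := Int.lt_floor_add_one x
      have hne : (⌊x⌋ : ℝ) ≠ x := fun e => h ⟨_, e⟩
      have hlt := lt_of_le_of_ne hl hne
      push_cast
      constructor <;> linarith
    omega

theorem W_mono {x y : ℝ} (h : x ≤ y) : W x ≤ W y := by
  rw [W_eq, W_eq]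
  exact add_le_add (Int.floor_mono h) (Int.ceil_mono h)

theorem one_le_W {x : ℝ} (h : 0 < x) : 1 ≤ W x := by
  rw [W_eq]
  have h1 : 0 ≤ ⌊x⌋ := Int.floor_nonneg.2 h.le
  have h2 : 0 < ⌈x⌉ := Int.ceil_pos.2 h
  omega

/-- Layer-cake decomposition of a function on naturals. -/
theorem layer (G : ℕ → ℤ) (h0 : G 0 = 0) (N : ℕ) : ∀ n ≤ N,
    G n = ∑ j ∈ Finset.range N, if j < n then G (j + 1) - G j else 0 := by
  intro n hn
  rw [← Finset.sum_filter]
  have : (Finset.range N).filter (fun j => j < n) = Finset.range n := by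
    ext j; simp; omega
  rw [this, Finset.sum_range_sub, h0, sub_zero]

theorem layer_sum {ι : Type*} [Fintype ι] (G : ℕ → ℤ) (h0 : G 0 = 0) (N : ℕ) (f : ι → ℕ)
    (hf : ∀ i, f i ≤ N) :
    ∑ i, G (f i) = ∑ j ∈ Finset.range N,
      ((Finset.univ.filter (fun i => j < f i)).card : ℤ) * (G (j + 1) - G j) := by
  rw [Finset.sum_congr rfl (fun i _ => layer G h0 N (f i) (hf i)), Finset.sum_comm]
  refine Finset.sum_congr rfl fun j _ => ?_
  rw [← Finset.sum_filter, Finset.sum_const, nsmul_eq_mul]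

/-- Proposition 2.16: if the weights are compatibly weighted
(`#{i | K ≤ w i} ≥ #{i | w i ≤ −K}` for every positive integer `K`), then
`μ_λ ≤ μ_α` for every `λ > 0`. -/
theorem muLambda_le_muAlpha {ι : Type*} [Fintype ι] (w : ι → ℤ)
    (hcw : ∀ K : ℤ, 0 < K →
      (Finset.univ.filter (fun i => w i ≤ -K)).card ≤
        (Finset.univ.filter (fun i => K ≤ w i)).card) :
    ∀ lam : ℝ, 0 < lam → muLambda w lam ≤ muAlpha w := by
  intro lam hlam
  let G : ℕ → ℤ := fun n => if n = 0 then 0 else W (lam * (n : ℝ)) - 1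
  have h0 : G 0 = 0 := by simp [G]
  have hG : ∀ j, 0 ≤ G (j + 1) - G j := by
    intro j
    rcases Nat.eq_zero_or_pos j with rfl | hj
    · have := one_le_W hlam
      simp [G]; exact this
    · have h1 : W (lam * (j : ℝ)) ≤ W (lam * ((j + 1 : ℕ) : ℝ)) := by
        apply W_mono
        push_cast
        nlinarith
      simp only [G, hj.ne', Nat.succ_ne_zero, if_false]
      omega
  have key : muLambda w lam - muAlpha w = ∑ i, G (-w i).toNat - ∑ i, G (w i).toNat := by
    unfold muLambda muAlpha
    rw [Finset.card_filter, Finset.sum_filter]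
    push_cast
    rw [Finset.mul_sum, ← Finset.sum_sub_distrib, ← Finset.sum_sub_distrib]
    refine Finset.sum_congr rfl fun i _ => ?_
    rcases lt_trichotomy (w i) 0 with h | h | h
    · obtain ⟨n, hn⟩ : ∃ n : ℕ, w i = -(n : ℤ) := ⟨(-w i).toNat, by omega⟩
      have hn0 : n ≠ 0 := by omega
      have hp : 0 < n := by omega
      simp [hn, hn0, hp, G, W_neg]
      ring
    · simp [h]
    · obtain ⟨n, hn⟩ : ∃ n : ℕ, w i = (n : ℤ) := ⟨(w i).toNat, by omega⟩
      have hn0 : n ≠ 0 := by omega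
      simp [hn, hn0, G]
  have hN : ∀ i, (w i).natAbs ≤ ∑ i, (w i).natAbs := fun i =>
    Finset.single_le_sum (f := fun i => (w i).natAbs) (fun _ _ => Nat.zero_le _)
      (Finset.mem_univ i)
  rw [← sub_nonpos, key, sub_nonpos,
    layer_sum G h0 (∑ i, (w i).natAbs) (fun i => (-w i).toNat)
      (fun i => le_trans (by omega) (hN i)),
    layer_sum G h0 (∑ i, (w i).natAbs) (fun i => (w i).toNat)
      (fun i => le_trans (by omega) (hN i))]
  refine Finset.sum_le_sum fun j _ => mul_le_mul_of_nonneg_right ?_ (hG j)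
  have h := hcw (j + 1) (by omega)
  have e1 : (Finset.univ.filter (fun i => j < (-w i).toNat)) =
      Finset.univ.filter (fun i => w i ≤ -((j : ℤ) + 1)) := by
    ext i; simp only [Finset.mem_filter, Finset.mem_univ, true_and]; omega
  have e2 : (Finset.univ.filter (fun i => j < (w i).toNat)) =
      Finset.univ.filter (fun i => (j : ℤ) + 1 ≤ w i) := by
    ext i; simp only [Finset.mem_filter, Finset.mem_univ, true_and]; omega
  rw [e1, e2]
  exact_mod_cast h
end

section
/- (Lemma 2.18(3).) Let N be a positive integer and set P := #{i | 0 < w i}, Q := #{i | w i < 0}, μ := ∑ i, w i. Then there exists ε with 0 < ε < N such that for every λ' ∈ (N − ε, N) one has μ_{λ'} = μ_α − 2N·μ + 2(P − Q); equivalently μ_{λ'} = 2P − 2N·μ. -/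
/-- Lemma 2.18(3): just below an integer time `N`,
`μ_{N⁻} = μ_α − 2Nμ + 2(|H₊| − |H₋|)`, equivalently `μ_{N⁻} = 2|H₊| − 2Nμ`, where
`|H₊| = #{i | 0 < w i}`, `|H₋| = #{i | w i < 0}`, and `μ = ∑ i, w i`. -/
theorem muLambda_just_below_integer {ι : Type*} [Fintype ι] (w : ι → ℤ) (N : ℕ)
    (hN : 0 < N) :
    ∃ ε : ℝ, 0 < ε ∧ ε < (N : ℝ) ∧
      ∀ lam' ∈ Set.Ioo ((N : ℝ) - ε) (N : ℝ),
        muLambda w lam' =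
          muAlpha w - 2 * (N : ℤ) * (∑ i, w i) +
            2 * (((Finset.univ.filter (fun i => 0 < w i)).card : ℤ)
              - ((Finset.univ.filter (fun i => w i < 0)).card : ℤ)) ∧
        muLambda w lam' =
          2 * ((Finset.univ.filter (fun i => 0 < w i)).card : ℤ)
            - 2 * (N : ℤ) * (∑ i, w i) := by
  have hS : (0 : ℝ) ≤ ∑ i, |(w i : ℝ)| := Finset.sum_nonneg fun i _ => abs_nonneg _
  have hN1 : (1 : ℝ) ≤ N := by exact_mod_cast hN
  refine ⟨1 / (2 + ∑ i, |(w i : ℝ)|), by positivity, ?_, ?_⟩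
  · refine lt_of_lt_of_le ?_ hN1
    rw [div_lt_one (by positivity)]
    linarith
  rintro lam ⟨hl1, hl2⟩
  have key : muLambda w lam =
      2 * ((Finset.univ.filter (fun i => 0 < w i)).card : ℤ) - 2 * (N : ℤ) * (∑ i, w i) := by
    unfold muLambda
    rw [Finset.sum_filter, Finset.card_filter, Nat.cast_sum, Finset.mul_sum, Finset.mul_sum,
      ← Finset.sum_sub_distrib]
    refine Finset.sum_congr rfl fun i _ => ?_
    have hi : |(w i : ℝ)| ≤ ∑ i, |(w i : ℝ)| :=
      Finset.single_le_sum (f := fun i => |(w i : ℝ)|) (fun i _ => abs_nonneg _)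
        (Finset.mem_univ i)
    have hd : ((N : ℝ) - lam) * (2 + ∑ i, |(w i : ℝ)|) < 1 := by
      rw [← lt_div_iff₀ (by positivity)]
      linarith
    have hd' : ((N : ℝ) - lam) * |(w i : ℝ)| < 1 := by
      refine lt_of_le_of_lt (mul_le_mul_of_nonneg_left ?_ (by linarith)) hd
      linarith
    rcases lt_trichotomy (w i) 0 with h | h | h
    · have hr : (w i : ℝ) < 0 := by exact_mod_cast h
      rw [abs_of_neg hr] at hd'
      have hp : 0 < ((N : ℝ) - lam) * (-(w i : ℝ)) := mul_pos (by linarith) (by linarith)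
      rw [W_of_between (lam * w i) (N * w i) (by push_cast; linarith) (by push_cast; linarith),
        if_pos h.ne, if_neg (by omega)]
      push_cast
      ring
    · simp [h]
    · have hr : (0 : ℝ) < w i := by exact_mod_cast h
      rw [abs_of_pos hr] at hd'
      have hp : 0 < ((N : ℝ) - lam) * (w i : ℝ) := mul_pos (by linarith) hr
      rw [W_of_between (lam * w i) (N * w i - 1) (by push_cast; linarith)
        (by push_cast; linarith), if_pos h.ne', if_pos h]
      push_cast
      ring
  refine ⟨?_, key⟩
  rw [key]
  unfold muAlpha
  ring
end
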